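/- For every n ≥ 1, if the superdiagonal entry d'(n) = A(n−1,n) of the Hurt-Sada array satisfies d'(n) < n, then d'(n) = ⌊(4 − 2φ)n⌋. -/

import Mathlib

/-- The golden ratio `(1 + √5)/2`. -/
noncomputable def phi : ℝ := (1 + Real.sqrt 5) / 2

/-- The Hurt-Sada array `A : ℕ → ℕ → ℕ`.  Row `0` is the identity sequence;
row `n+1` is obtained from row `n` by moving the entry `n+1` (located at the unique
position `p` with `A n p = n+1`) by `n+1` places to the right, shifting the jumped-over
entries one place left. -/
noncomputable def A : ℕ → ℕ → ℕ
  | 0, k => k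
  | n + 1, j =>
    let p := sInf {i | A n i = n + 1}
    if j < p then A n j
    else if j < p + (n + 1) then A n (j + 1)
    else if j = p + (n + 1) then n + 1
    else A n j

lemma phi_sq : phi ^ 2 = phi + 1 := Real.goldenRatio_sq

lemma phi_lower : 1.6 < phi := by
  have h := phi_sq
  have h1 : 1 < phi := Real.one_lt_goldenRatio
  nlinarith

lemma phi_upper : phi < 1.62 := by
  have h := phi_sq
  have h1 : 1 < phi := Real.one_lt_goldenRatio
  nlinarith

lemma mul_phi_ne_natCast {k : ℕ} (hk : 0 < k) (N : ℕ) : (k : ℝ) * phi ≠ N :=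
  (Irrational.natCast_mul Real.goldenRatio_irrational hk.ne').ne_nat N

/-- The lower Wythoff sequence `⌊k φ⌋`. -/
noncomputable def lowerWythoff (k : ℕ) : ℕ := ⌊(k : ℝ) * phi⌋₊

/-- The upper Wythoff sequence `⌊k φ²⌋ = ⌊k φ⌋ + k`. -/
noncomputable def upperWythoff (k : ℕ) : ℕ := lowerWythoff k + k

lemma lowerWythoff_le (k : ℕ) : (lowerWythoff k : ℝ) ≤ k * phi :=
  Nat.floor_le (mul_nonneg k.cast_nonneg (by linarith [phi_lower]))

lemma lt_lowerWythoff_add_one (k : ℕ) : (k : ℝ) * phi < lowerWythoff k + 1 :=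
  Nat.lt_floor_add_one _

lemma lowerWythoff_lt {k : ℕ} (hk : 0 < k) : (lowerWythoff k : ℝ) < k * phi :=
  lt_of_le_of_ne (lowerWythoff_le k) (mul_phi_ne_natCast hk _).symm

lemma lowerWythoff_eq {k N : ℕ} (h₁ : (N : ℝ) ≤ k * phi) (h₂ : (k : ℝ) * phi < N + 1) :
    lowerWythoff k = N :=
  (Nat.floor_eq_iff (N.cast_nonneg.trans h₁)).2 ⟨h₁, h₂⟩

lemma lowerWythoff_one : lowerWythoff 1 = 1 :=
  lowerWythoff_eq (by push_cast; linarith [phi_lower]) (by push_cast; linarith [phi_upper])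

lemma lowerWythoff_two : lowerWythoff 2 = 3 :=
  lowerWythoff_eq (by push_cast; linarith [phi_lower]) (by push_cast; linarith [phi_upper])

lemma lowerWythoff_three : lowerWythoff 3 = 4 :=
  lowerWythoff_eq (by push_cast; linarith [phi_lower]) (by push_cast; linarith [phi_upper])

lemma lowerWythoff_succ_ge (k : ℕ) : lowerWythoff k + 1 ≤ lowerWythoff (k + 1) := by
  have h₁ := lowerWythoff_le k
  have h₂ := lt_lowerWythoff_add_one (k + 1)
  have h₃ := phi_lower
  push_cast at h₂
  have : (lowerWythoff k : ℝ) < lowerWythoff (k + 1) := by linarith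
  exact_mod_cast this

lemma lowerWythoff_succ_le (k : ℕ) : lowerWythoff (k + 1) ≤ lowerWythoff k + 2 := by
  have h₁ := lt_lowerWythoff_add_one k
  have h₂ := lowerWythoff_le (k + 1)
  have h₃ := phi_upper
  push_cast at h₂
  have : (lowerWythoff (k + 1) : ℝ) < lowerWythoff k + 3 := by linarith
  have : lowerWythoff (k + 1) < lowerWythoff k + 3 := by exact_mod_cast this
  omega

lemma lowerWythoff_strictMono : StrictMono lowerWythoff :=
  strictMono_nat_of_lt_succ lowerWythoff_succ_ge

lemma upperWythoff_strictMono : StrictMono upperWythoff :=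
  lowerWythoff_strictMono.add strictMono_id

lemma lowerWythoff_add_one_le {k : ℕ} (hk : 0 < k) : lowerWythoff k + 1 ≤ 2 * k := by
  induction k, hk using Nat.le_induction with
  | base => simp [lowerWythoff_one]
  | succ k _ ih => have := lowerWythoff_succ_le k; omega

lemma upperWythoff_le (k : ℕ) : (upperWythoff k : ℝ) ≤ k * phi + k := by
  have := lowerWythoff_le k
  rw [upperWythoff]; push_cast; linarith

lemma lt_upperWythoff_add_one (k : ℕ) : (k : ℝ) * phi + k < upperWythoff k + 1 := by
  have := lt_lowerWythoff_add_one k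
  rw [upperWythoff]; push_cast; linarith

lemma lowerWythoff_ne_upperWythoff {k : ℕ} (hk : 0 < k) (c : ℕ) :
    lowerWythoff k ≠ upperWythoff c := by
  intro h
  have h₁ := lowerWythoff_lt hk
  have h₂ := lt_lowerWythoff_add_one k
  have h₃ := upperWythoff_le c
  have h₄ := lt_upperWythoff_add_one c
  rw [← h] at h₃ h₄
  set N := lowerWythoff k
  have hφ := phi_sq
  have hpos := phi_lower
  have lo : (N : ℝ) < k + c := by
    refine lt_of_mul_lt_mul_right (a := phi ^ 2) ?_ (by positivity)
    nlinarith
  have hi : (k + c : ℝ) < N + 1 := by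
    refine lt_of_mul_lt_mul_right (a := phi ^ 2) ?_ (by positivity)
    nlinarith
  have lo' : N < k + c := by exact_mod_cast lo
  have hi' : k + c < N + 1 := by exact_mod_cast hi
  omega

lemma exists_lowerWythoff_or_upperWythoff (N : ℕ) :
    (∃ k, lowerWythoff k = N) ∨ ∃ c, upperWythoff c = N := by
  have hφ := phi_sq
  have hpos := phi_lower
  by_cases hN : ∃ k, lowerWythoff k = N
  · exact .inl hN
  refine .inr ?_
  have hex : ∃ k, N ≤ lowerWythoff k := ⟨N, lowerWythoff_strictMono.le_apply⟩
  obtain ⟨k, hk, hk'⟩ : ∃ k, lowerWythoff k < N ∧ N < lowerWythoff (k + 1) := by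
    classical
    have h₁ := Nat.find_spec hex
    have h₀ : Nat.find hex ≠ 0 := by
      intro h
      rw [h] at h₁
      have h0 : lowerWythoff 0 = 0 := by simp [lowerWythoff]
      exact hN ⟨0, by omega⟩
    obtain ⟨k, hk⟩ := Nat.exists_eq_succ_of_ne_zero h₀
    have h₂ := Nat.find_min hex (m := k) (by omega)
    rw [hk] at h₁
    exact ⟨k, by omega, lt_of_le_of_ne h₁ fun h => hN ⟨_, h.symm⟩⟩
  have hkN : k ≤ N := lowerWythoff_strictMono.le_apply.trans hk.le
  refine ⟨N - k, ?_⟩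
  have hlow : (k : ℝ) * phi < N := (lt_lowerWythoff_add_one k).trans_le (by exact_mod_cast hk)
  have hhigh : (N + 1 : ℝ) < (k + 1) * phi := by
    have h := lowerWythoff_lt k.succ_pos
    push_cast at h
    exact lt_of_le_of_lt (by exact_mod_cast hk') h
  have : lowerWythoff (N - k) = k := by
    apply lowerWythoff_eq <;> push_cast [hkN]
    · nlinarith
    · nlinarith
  rw [upperWythoff, this]; omega

lemma lowerWythoff_eq_of_between {k c : ℕ} (h₁ : upperWythoff c < lowerWythoff k)
    (h₂ : lowerWythoff k < upperWythoff (c + 1)) : lowerWythoff k = k + c := by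
  have hφ := phi_sq
  have hpos := phi_lower
  have h₁' : (upperWythoff c : ℝ) + 1 ≤ lowerWythoff k := by exact_mod_cast h₁
  have h₂' : (lowerWythoff k : ℝ) + 1 ≤ upperWythoff (c + 1) := by exact_mod_cast h₂
  have h₃ := lowerWythoff_le k
  have h₄ := lt_lowerWythoff_add_one k
  have h₅ := lt_upperWythoff_add_one c
  have h₆ := upperWythoff_le (c + 1)
  push_cast at h₆
  have hlow : (c : ℝ) * phi < k := by
    refine lt_of_mul_lt_mul_right (a := phi) ?_ (by positivity)
    nlinarith
  have hhigh : (k : ℝ) < (c + 1) * phi := by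
    refine lt_of_mul_lt_mul_right (a := phi) ?_ (by positivity)
    nlinarith
  apply lowerWythoff_eq <;> push_cast <;> nlinarith

lemma upperWythoff_of_gap {k K : ℕ} (h : lowerWythoff (k + 1) = lowerWythoff k + 2)
    (hK : K + k = lowerWythoff k + 1) : upperWythoff K = lowerWythoff k + 1 := by
  have hφ := phi_sq
  have hpos := phi_lower
  have hK' : (K : ℝ) = lowerWythoff k + 1 - k := by
    have : (K : ℝ) + k = lowerWythoff k + 1 := by exact_mod_cast hK
    linarith
  have h₁ := lt_lowerWythoff_add_one k
  have h₂ := lowerWythoff_lt k.succ_pos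
  rw [Nat.succ_eq_add_one, h] at h₂
  push_cast at h₂
  have : lowerWythoff K = k := by
    apply lowerWythoff_eq <;> rw [hK'] <;> nlinarith
  rw [upperWythoff, this]; omega

/-- Row `n` of the Hurt-Sada array is the identity outside a window, inside which the values
are read off from the complementary Wythoff sequences. -/
structure RowShape (n : ℕ) : Prop where
  left : ∀ q, q + n + 2 < lowerWythoff (n + 2) → A n q = q
  right : ∀ q, lowerWythoff (n + 1) ≤ q → A n q = q
  lower : ∀ q m, lowerWythoff (n + 2) ≤ q + n + 2 → q + n + 2 ≤ upperWythoff (n + 1) →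
    q + n + 2 = lowerWythoff (m + 1) → A n q = m
  upper : ∀ q m, lowerWythoff (n + 2) ≤ q + n + 2 → q + n + 2 ≤ upperWythoff (n + 1) →
    q + n + 2 = upperWythoff (m + 1) → A n q = m

lemma rowShape_zero : RowShape 0 where
  left _ _ := rfl
  right _ _ := rfl
  lower q m h₁ h₂ _ := by
    simp only [upperWythoff, zero_add, lowerWythoff_one, lowerWythoff_two] at h₁ h₂; omega
  upper q m h₁ h₂ _ := by
    simp only [upperWythoff, zero_add, lowerWythoff_one, lowerWythoff_two] at h₁ h₂; omega

lemma RowShape.sInf_eq {n p : ℕ} (h : RowShape n) (hp : p + n + 2 = lowerWythoff (n + 2)) :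
    sInf {i | A n i = n + 1} = p := by
  have hlt := lowerWythoff_add_one_le (k := n + 2) (by omega)
  have hstep : lowerWythoff (n + 2) ≤ lowerWythoff (n + 1) + 2 := lowerWythoff_succ_le (n + 1)
  have hmem : A n p = n + 1 := by
    rcases Nat.eq_zero_or_pos n with rfl | hn
    · rw [zero_add, lowerWythoff_two] at hp
      simp only [A]; omega
    · exact h.lower p (n + 1) hp.ge (by simp only [upperWythoff]; omega) hp
  refine le_antisymm (Nat.sInf_le hmem) (le_csInf ⟨p, hmem⟩ fun i hi => ?_)
  by_contra! hip
  have := h.left i (by omega)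
  rw [Set.mem_ofPred_eq] at hi
  omega

lemma RowShape.succ {n : ℕ} (h : RowShape n) : RowShape (n + 1) := by
  have hle : n + 2 ≤ lowerWythoff (n + 2) := lowerWythoff_strictMono.le_apply
  obtain ⟨p, hp⟩ : ∃ p, p + n + 2 = lowerWythoff (n + 2) :=
    ⟨lowerWythoff (n + 2) - (n + 2), by omega⟩
  have hA : ∀ j, A (n + 1) j = if j < p then A n j else if j < p + (n + 1) then A n (j + 1)
      else if j = p + (n + 1) then n + 1 else A n j := by
    intro j
    rw [A, h.sInf_eq hp]
  have s₁ := lowerWythoff_succ_ge (n + 1)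
  have s₂ := lowerWythoff_succ_le (n + 1)
  have s₃ := lowerWythoff_succ_ge (n + 2)
  have s₄ := lowerWythoff_succ_le (n + 2)
  have hu₁ : upperWythoff (n + 1) = lowerWythoff (n + 1) + (n + 1) := rfl
  have hu₂ : upperWythoff (n + 2) = lowerWythoff (n + 2) + (n + 2) := rfl
  simp only [add_assoc, Nat.reduceAdd] at s₁ s₂ s₃ s₄
  refine ⟨fun q hq => ?_, fun q hq => ?_, fun q m h₁ h₂ hm => ?_, fun q m h₁ h₂ hm => ?_⟩
  all_goals simp only [add_assoc, Nat.reduceAdd] at *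
  · rw [hA]
    by_cases hqp : q < p
    · rw [if_pos hqp]
      exact h.left q (by omega)
    · rw [if_neg hqp, if_pos (by omega)]
      have hn : n ≠ 0 := by
        rintro rfl
        simp only [zero_add, lowerWythoff_two, lowerWythoff_three] at *
        omega
      have hn₁ : n = 1 → lowerWythoff (n + 1) = 3 ∧ lowerWythoff (n + 2) = 4 := by
        rintro rfl; exact ⟨lowerWythoff_two, lowerWythoff_three⟩
      have hgap : upperWythoff (q + 1) = lowerWythoff (n + 2) + 1 :=
        upperWythoff_of_gap (by simp only [add_assoc, Nat.reduceAdd]; omega) (by omega)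
      exact h.upper (q + 1) q (by omega) (by omega) (by omega)
  · rw [hA, if_neg (by omega), if_neg (by omega), if_neg (by omega)]
    exact h.right q (by omega)
  · rw [hA, if_neg (by omega)]
    have hne := lowerWythoff_ne_upperWythoff m.succ_pos (n + 2)
    rw [Nat.succ_eq_add_one] at hne
    rw [if_pos (by omega)]
    by_cases hw : q + (n + 3) ≤ upperWythoff (n + 1)
    · exact h.lower (q + 1) m (by omega) (by omega) (by omega)
    · rw [h.right (q + 1) (by omega)]
      have := lowerWythoff_eq_of_between (k := m + 1) (c := n + 1) (by omega)
        (by simp only [add_assoc, Nat.reduceAdd]; omega)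
      omega
  · rw [hA, if_neg (by omega)]
    by_cases hw : q + (n + 3) ≤ upperWythoff (n + 1)
    · rw [if_pos (by omega)]
      exact h.upper (q + 1) m (by omega) (by omega) (by omega)
    · have hlt : n + 1 < m + 1 := upperWythoff_strictMono.lt_iff_lt.1 (by omega)
      have hle : m + 1 ≤ n + 2 := upperWythoff_strictMono.le_iff_le.1 (by omega)
      obtain rfl : m = n + 1 := by omega
      simp only [add_assoc, Nat.reduceAdd] at hm
      rw [if_neg (by omega), if_pos (by omega)]

lemma rowShape (n : ℕ) : RowShape n := by
  induction n with
  | zero => exact rowShape_zero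
  | succ n ih => exact ih.succ

theorem superdiagonal_lt_formula (n : ℕ) (hn : 1 ≤ n) (h : A (n - 1) n < n) :
    A (n - 1) n = ⌊(4 - 2 * phi) * (n : ℝ)⌋₊ := by
  obtain ⟨r, rfl⟩ : ∃ r, n = r + 1 := ⟨n - 1, by omega⟩
  rw [Nat.add_sub_cancel] at h ⊢
  have hr := rowShape r
  have hleft : lowerWythoff (r + 2) ≤ r + 1 + r + 2 := by
    by_contra! hc
    have := hr.left (r + 1) hc
    omega
  have hright : r + 1 < lowerWythoff (r + 1) := by
    by_contra! hc
    have := hr.right (r + 1) hc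
    omega
  have hwin : r + 1 + r + 2 ≤ upperWythoff (r + 1) := by
    rw [upperWythoff]; omega
  rcases exists_lowerWythoff_or_upperWythoff (r + 1 + r + 2) with ⟨k, hk⟩ | ⟨c, hc⟩
  · have hrk : r + 2 ≤ k := lowerWythoff_strictMono.le_iff_le.1 (hk ▸ hleft)
    obtain ⟨m, rfl⟩ : ∃ m, k = m + 1 := ⟨k - 1, by omega⟩
    have := hr.lower (r + 1) m hleft hwin hk.symm
    omega
  · obtain ⟨m, rfl⟩ : ∃ m, c = m + 1 := by
      refine ⟨c - 1, ?_⟩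
      rcases c with _ | c
      · simp [upperWythoff, lowerWythoff] at hc
      · omega
    rw [hr.upper (r + 1) m hleft hwin hc.symm]
    have hφ := phi_sq
    have h₀ := phi_lower
    have h₁ := phi_upper
    have h₂ := upperWythoff_le (m + 1)
    have h₃ := lt_upperWythoff_add_one (m + 1)
    rw [hc] at h₂ h₃
    push_cast at h₂ h₃ ⊢
    have hpos : 0 < 2 - phi := by linarith
    have e₂ := mul_le_mul_of_nonneg_left h₂ hpos.le
    have e₃ := mul_lt_mul_of_pos_left h₃ hpos
    refine ((Nat.floor_eq_iff (mul_nonneg (by linarith) (by positivity))).2 ⟨?_, ?_⟩).symm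
    · nlinarith
    · nlinarith
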